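/- arXiv:2005.10399 — 2 statements merged into one kernel-verified Lean document; each statement's English description precedes it below -/
import Mathlib

section
/- There exists a set A of elements of Cantor space 2^ω such that every uncountable Borel subset of 2^ω intersects both A and its complement. Equivalently, there exists a total totally pathological function F : 2^ω → 2 (namely the indicator function of A). -/
open Cardinal in
/-- A family of sets indexed by `ι`, each of cardinality at least that of `ι`, has an injective
choice function. -/
theorem exists_injective_forall_mem_of_mk_le.{u, v} {ι : Type u} {α : Type v}
    (s : ι → Set α) (hs : ∀ i, lift.{v} #ι ≤ lift.{u} #(s i)) :
    ∃ g : ι → α, Function.Injective g ∧ ∀ i, g i ∈ s i := by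
  obtain ⟨_, _, hι⟩ := exists_ord_eq_type_lt ι
  have step : ∀ i (f : ∀ j, j < i → α), ∃ x ∈ s i, ∀ j hj, f j hj ≠ x := by
    intro i f
    by_contra! h
    have hsub : s i ⊆ Set.range fun j : Set.Iio i ↦ f j.1 j.2 := fun x hx ↦
      let ⟨j, hj, hjx⟩ := h x hx
      ⟨⟨j, hj⟩, hjx⟩
    have hle := (lift_le.2 (mk_le_mk_of_subset hsub)).trans mk_range_le_lift
    exact (((hs i).trans hle).trans_lt (lift_lt.2 (mk_Iio_lt i hι))).false
  choose F hFs hF using step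
  let g : ι → α := wellFounded_lt.fix F
  have hfix : ∀ i, g i = F i fun j _ ↦ g j := wellFounded_lt.fix_eq F
  have hne : ∀ i j, j < i → g j ≠ g i := fun i j hji ↦ by
    rw [hfix i]
    exact hF i (fun j _ ↦ g j) j hji
  refine ⟨g, fun i j hij ↦ ?_, fun i ↦ ?_⟩
  · rcases lt_trichotomy i j with h | h | h
    · exact absurd hij (hne j i h)
    · exact h
    · exact absurd hij.symm (hne i j h)
  · rw [hfix i]
    exact hFs i _

open Cardinal in
/-- In a standard Borel space every uncountable measurable set has at least continuum many
elements. -/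
theorem MeasurableSet.continuum_le_mk_of_not_countable {α : Type*} [MeasurableSpace α]
    [StandardBorelSpace α] {B : Set α} (hB : MeasurableSet B) (hc : ¬ B.Countable) :
    𝔠 ≤ #B := by
  have := hB.standardBorel
  have e := (PolishSpace.measurableEquivNatBoolOfNotCountable
    (α := B) (mt Set.countable_coe_iff.1 hc)).toEquiv
  simpa using (mk_congr_lift e).ge

open Cardinal in
/-- In a countably generated measurable space there are at most continuum many measurable sets. -/
theorem MeasurableSpace.mk_measurableSet_le_continuum (α : Type*) [MeasurableSpace α]
    [h : MeasurableSpace.CountablyGenerated α] : #{B : Set α // MeasurableSet B} ≤ 𝔠 := by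
  obtain ⟨b, hb, rfl⟩ := h.isCountablyGenerated
  exact cardinal_measurableSet_le_continuum
    ((le_aleph0_iff_set_countable.2 hb).trans aleph0_le_continuum)

/-- There is a set `A` of elements of Cantor space `2^ω` (modeled as
`ℕ → Bool`) such that every uncountable Borel subset of `2^ω` intersects both `A`
and its complement.  (Equivalently, the indicator function of `A` is a total
totally pathological function `F : 2^ω → 2`.) -/
theorem exists_totally_pathological_set :
    ∃ A : Set (ℕ → Bool),
      ∀ B : Set (ℕ → Bool), MeasurableSet B → ¬ B.Countable →
        (B ∩ A).Nonempty ∧ (B ∩ Aᶜ).Nonempty := by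
  let S := {B : Set (ℕ → Bool) // MeasurableSet B ∧ ¬ B.Countable}
  have hS : Cardinal.mk (S × Bool) ≤ Cardinal.continuum := by
    have h : Cardinal.mk S ≤ Cardinal.continuum :=
      (Cardinal.mk_subtype_mono fun _ hB ↦ hB.1).trans
        (MeasurableSpace.mk_measurableSet_le_continuum (ℕ → Bool))
    rw [Cardinal.mk_prod, Cardinal.lift_id, Cardinal.lift_id]
    exact Cardinal.mul_le_of_le Cardinal.aleph0_le_continuum h
      (Cardinal.mk_le_aleph0.trans Cardinal.aleph0_le_continuum)
  obtain ⟨g, hg, hmem⟩ := exists_injective_forall_mem_of_mk_le (fun p : S × Bool ↦ p.1.1)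
    fun p ↦ Cardinal.lift_le.2 (hS.trans (p.1.2.1.continuum_le_mk_of_not_countable p.1.2.2))
  refine ⟨Set.range fun B : S ↦ g (B, true), fun B hB hc ↦
    ⟨⟨g (⟨B, hB, hc⟩, true), hmem (⟨B, hB, hc⟩, true), ⟨B, hB, hc⟩, rfl⟩,
      ⟨g (⟨B, hB, hc⟩, false), hmem (⟨B, hB, hc⟩, false), ?_⟩⟩⟩
  rintro ⟨C, hC⟩
  simpa using congrArg Prod.snd (hg hC)
end

section
/- If F : 2^ω → 2 is a totally pathological partial function, then the fiber F⁻¹[{0}] is an uncountable subset of 2^ω that contains no nonempty perfect subset. In particular, the existence of a totally pathological function implies the existence of an uncountable set without the perfect set property. -/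
theorem cantorSpace_not_countable_univ : ¬ (Set.univ : Set (ℕ → Bool)).Countable := by
  rw [← Cardinal.le_aleph0_iff_set_countable, not_le, Cardinal.mk_univ]
  simpa using Cardinal.aleph0_lt_continuum

theorem Perfect.not_countable {α : Type*} [TopologicalSpace α]
    [TopologicalSpace.IsCompletelyMetrizableSpace α] {P : Set α} (hP : Perfect P)
    (hne : P.Nonempty) : ¬ P.Countable := by
  let _ := TopologicalSpace.upgradeIsCompletelyMetrizable α
  obtain ⟨f, hfP, -, hf⟩ := hP.exists_nat_bool_injection hne
  intro hc
  apply cantorSpace_not_countable_univ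
  refine Set.countable_of_injective_of_countable_image hf.injOn ?_
  rw [Set.image_univ]
  exact hc.mono hfP

/-- If `F : 2^ω → 2` is a totally pathological partial function
(modeled as `F : (ℕ → Bool) → Option (Fin 2)`, with `F x = none` meaning that `x`
is not in the domain of `F`), then the fiber `F⁻¹[{0}]` is an uncountable subset
of Cantor space containing no nonempty perfect subset. -/
theorem totallyPathological_fiber_uncountable_no_perfect_subset
    (F : (ℕ → Bool) → Option (Fin 2))
    (hF : ∀ i : Fin 2, ∀ B : Set (ℕ → Bool), MeasurableSet B → ¬ B.Countable →
      ∃ x ∈ B, F x = some i) :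
    ¬ {x : ℕ → Bool | F x = some 0}.Countable ∧
      ∀ P : Set (ℕ → Bool), P ⊆ {x : ℕ → Bool | F x = some 0} → Perfect P →
        P = ∅ := by
  refine ⟨fun hc => ?_, fun P hP hperf => ?_⟩
  · obtain ⟨x, hx, hx0⟩ := hF 0 _ hc.measurableSet.compl fun hcompl =>
      cantorSpace_not_countable_univ (by
        rw [← Set.union_compl_self {x | F x = some 0}]
        exact hc.union hcompl)
    exact hx hx0
  · by_contra hne
    obtain ⟨x, hx, hx1⟩ := hF 1 P hperf.closed.measurableSet
      (hperf.not_countable (Set.nonempty_iff_ne_empty.mpr hne))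
    have hx0 : F x = some 0 := hP hx
    simp [hx0] at hx1
end
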